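/- The constituent tensor T_{i,j,0}^{⊗n}[β_X, β_Y, β_Z] of the CW tensor power (with third index 0 and exact complete split distributions enforced) is isomorphic to a matrix multiplication tensor ⟨1, M, 1⟩ where M is the number of X-variables remaining, namely M = 2^{n(H(β_X) ± o(1))} · q^{n ∑_σ β_X(σ) · #{p : σ_p = 1}}, with the sum over chunks σ ∈ {0,1,2}^{2^{ℓ-1}}. -/

import Mathlib

open Finset
open scoped Classical

/-- The coefficient of `x_i y_j z_k` in the Coppersmith–Winograd tensor `CW_q`. -/
def cwCoef (q : ℕ) (x y z : Fin (q + 2)) : ℝ :=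
  if (x.val = 0 ∧ y.val = 0 ∧ z.val = q + 1) ∨ (x.val = 0 ∧ y.val = q + 1 ∧ z.val = 0) ∨
     (x.val = q + 1 ∧ y.val = 0 ∧ z.val = 0) ∨
     (x.val = 0 ∧ 1 ≤ y.val ∧ y.val ≤ q ∧ z = y) ∨
     (1 ≤ x.val ∧ x.val ≤ q ∧ y.val = 0 ∧ z = x) ∨
     (1 ≤ x.val ∧ x.val ≤ q ∧ y = x ∧ z.val = 0) then 1 else 0

/-- The level-1 block index of a variable of `CW_q`, as an element of `{0,1,2}`. -/
def blkF (q : ℕ) (x : Fin (q + 2)) : Fin 3 :=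
  if x.val = 0 then 0 else if x.val = q + 1 then 2 else 1

/-- The complete split distribution of a variable index sequence of `CW_q^{⊗ c·n}`
(grouped into `n` chunks of length `c`): the empirical distribution, over the `n` chunks,
of the chunk types in `{0,1,2}^c` obtained by taking level-1 block indices. -/
noncomputable def splitDist (q c n : ℕ) (x : Fin n → Fin c → Fin (q + 2)) :
    (Fin c → Fin 3) → ℝ :=
  fun σ => ((univ.filter fun t => (fun p => blkF q (x t p)) = σ).card : ℝ) / n

/-- The tensor `T^{⊗n}[β_X, β_Y, β_Z]`: the `n`-th power of `CW_q^{⊗c}` restricted to the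
level-1 variable blocks whose complete split distributions exactly equal `β_X, β_Y, β_Z`. -/
noncomputable def crestr (q c n : ℕ) (βX βY βZ : (Fin c → Fin 3) → ℝ)
    (x y z : Fin n → Fin c → Fin (q + 2)) : ℝ :=
  if splitDist q c n x = βX ∧ splitDist q c n y = βY ∧ splitDist q c n z = βZ then
    ∏ t, ∏ p, cwCoef q (x t p) (y t p) (z t p)
  else 0

/-- The duality on variables of `CW_q` that exchanges the two extreme variables. -/
def cwDual (q : ℕ) (x : Fin (q + 2)) : Fin (q + 2) :=
  if x.val = 0 then Fin.last (q + 1) else if x.val = q + 1 then 0 else x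

theorem cwDual_involutive (q : ℕ) : Function.Involutive (cwDual q) := by
  intro x
  unfold cwDual
  ext
  split_ifs <;> simp_all

theorem cwCoef_zero_right (q : ℕ) (x y : Fin (q + 2)) :
    cwCoef q x y 0 = if y = cwDual q x then 1 else 0 := by
  have hx := x.isLt
  have hy := y.isLt
  have h0 : (0 : Fin (q + 2)).val = 0 := rfl
  unfold cwCoef cwDual
  congr 1
  simp only [Fin.ext_iff, h0, eq_iff_iff]
  split_ifs <;> (try simp only [Fin.val_last, h0]) <;> grind

theorem blkF_cwDual (q : ℕ) (x : Fin (q + 2)) : blkF q (cwDual q x) = 2 - blkF q x := by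
  unfold blkF cwDual
  split_ifs <;> simp_all

theorem blkF_eq_zero_iff (q : ℕ) (x : Fin (q + 2)) : blkF q x = 0 ↔ x = 0 := by
  rw [← Fin.val_eq_zero_iff (a := x)]
  unfold blkF
  split_ifs with h h' <;> simp only [h, iff_false] <;> decide

theorem card_filter_blkF (q : ℕ) (a : Fin 3) :
    (univ.filter fun v => blkF q v = a).card = if a = 1 then q else 1 := by
  rw [card_filter, Fin.sum_univ_succ, Fin.sum_univ_castSucc]
  have h : ∀ i : Fin q, i.val ≠ q := fun i => i.isLt.ne
  fin_cases a <;> simp [blkF, h]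

theorem card_filter_blkF_comp (q c : ℕ) (σ : Fin c → Fin 3) :
    (univ.filter fun a : Fin c → Fin (q + 2) => (fun p => blkF q (a p)) = σ).card =
      q ^ (univ.filter fun p => σ p = 1).card := by
  have h : (univ.filter fun a : Fin c → Fin (q + 2) => (fun p => blkF q (a p)) = σ) =
      Fintype.piFinset fun p => univ.filter fun v => blkF q v = σ p := by
    ext a
    simp [funext_iff]
  rw [h, Fintype.card_piFinset]
  simp_rw [card_filter_blkF]
  rw [prod_ite]
  simp

/-- The number of sequences over `A` whose image under `τ` has prescribed letter counts. -/
theorem card_filter_fiber_counts {A Ω : Type*} [Fintype A] [Fintype Ω] [DecidableEq Ω]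
    (τ : A → Ω) (n : ℕ) (m : Ω → ℕ) (hm : ∑ σ, m σ = n) :
    (univ.filter fun x : Fin n → A =>
        ∀ σ, (univ.filter fun t => τ (x t) = σ).card = m σ).card =
      Nat.multinomial univ m * ∏ σ, (univ.filter fun a => τ a = σ).card ^ m σ := by
  have hX : ∀ f : Ω → ℕ, (∏ σ, (MvPolynomial.X σ : MvPolynomial Ω ℕ) ^ f σ) =
      MvPolynomial.monomial (Finsupp.equivFunOnFinite.symm f) 1 := by
    intro f
    rw [MvPolynomial.monomial_eq, Finsupp.prod_fintype _ _ (by simp)]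
    simp
  have hcoeff : ∀ f : Ω → ℕ, MvPolynomial.coeff (Finsupp.equivFunOnFinite.symm m)
      (∏ σ, (MvPolynomial.X σ : MvPolynomial Ω ℕ) ^ f σ) = if f = m then 1 else 0 := by
    intro f
    rw [hX, MvPolynomial.coeff_monomial]
    simp
  have hl : (∑ a, (MvPolynomial.X (τ a) : MvPolynomial Ω ℕ)) ^ n =
      ∑ x : Fin n → A, ∏ σ, (MvPolynomial.X σ : MvPolynomial Ω ℕ) ^
        (univ.filter fun t => τ (x t) = σ).card := by
    rw [Fintype.sum_pow]
    refine sum_congr rfl fun x _ => ?_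
    rw [← prod_fiberwise univ (fun t => τ (x t))]
    refine prod_congr rfl fun σ _ => ?_
    rw [← prod_const]
    exact prod_congr rfl fun t ht => by rw [(mem_filter.1 ht).2]
  have hr : (∑ a, (MvPolynomial.X (τ a) : MvPolynomial Ω ℕ)) ^ n =
      ∑ k ∈ piAntidiag univ n, MvPolynomial.C
        (Nat.multinomial univ k * ∏ σ, (univ.filter fun a => τ a = σ).card ^ k σ) *
        ∏ σ, (MvPolynomial.X σ : MvPolynomial Ω ℕ) ^ k σ := by
    have : (∑ a, (MvPolynomial.X (τ a) : MvPolynomial Ω ℕ)) =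
        ∑ σ, MvPolynomial.C (univ.filter fun a => τ a = σ).card * MvPolynomial.X σ := by
      rw [← sum_fiberwise univ τ]
      refine sum_congr rfl fun σ _ => ?_
      rw [sum_congr rfl fun a ha => by rw [(mem_filter.1 ha).2], sum_const]
      simp
    rw [this, sum_pow_eq_sum_piAntidiag]
    refine sum_congr rfl fun k _ => ?_
    simp_rw [mul_pow]
    rw [prod_mul_distrib]
    simp [mul_assoc]
  have h := congrArg (MvPolynomial.coeff (Finsupp.equivFunOnFinite.symm m)) (hl.symm.trans hr)
  simp only [MvPolynomial.coeff_sum, MvPolynomial.coeff_C_mul, hcoeff] at h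
  rw [card_filter]
  simp only [funext_iff] at h
  rw [h]
  simp only [← funext_iff]
  simp [hm]

theorem log_factorial_bounds (n : ℕ) :
    n * Real.log n - n ≤ Real.log n.factorial ∧
      Real.log n.factorial ≤ n * Real.log n - n + (1 + Real.log n) := by
  rcases Nat.eq_zero_or_pos n with rfl | hn
  · simp
  induction n, hn using Nat.le_induction with
  | base => norm_num
  | succ n hn ih =>
    have hn0 : (0 : ℝ) < n := by exact_mod_cast hn
    have hn1 : (0 : ℝ) < (n : ℝ) + 1 := by positivity
    have hfac : Real.log (n + 1).factorial = Real.log ((n : ℝ) + 1) + Real.log n.factorial := by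
      rw [Nat.factorial_succ, Nat.cast_mul, Real.log_mul (by positivity) (by positivity)]
      push_cast
      rfl
    have h1 : n * (Real.log ((n : ℝ) + 1) - Real.log n) ≤ 1 := by
      rw [← Real.log_div hn1.ne' hn0.ne']
      have := Real.log_le_sub_one_of_pos (div_pos hn1 hn0)
      calc _ ≤ (n : ℝ) * ((n + 1) / n - 1) := by gcongr
        _ = 1 := by field_simp; ring
    have h2 : 1 ≤ ((n : ℝ) + 1) * (Real.log ((n : ℝ) + 1) - Real.log n) := by
      have := Real.log_le_sub_one_of_pos (div_pos hn0 hn1)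
      rw [Real.log_div hn0.ne' hn1.ne'] at this
      calc (1 : ℝ) = (n + 1) * -(n / (n + 1) - 1) := by field_simp; ring
        _ ≤ _ := by gcongr; linarith
    rw [hfac]
    push_cast
    constructor <;> linarith [ih.1, ih.2]

/-- The logarithm of a multinomial coefficient is the entropy up to a logarithmic error. -/
theorem abs_log_multinomial_sub_le {Ω : Type*} [Fintype Ω] (n : ℕ) (m : Ω → ℕ)
    (hm : ∑ σ, m σ = n) :
    |Real.log (Nat.multinomial univ m) - (n * Real.log n - ∑ σ, m σ * Real.log (m σ))| ≤
      (Fintype.card Ω + 1) * (1 + Real.log n) := by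
  have hspec : Real.log (Nat.multinomial univ m) =
      Real.log n.factorial - ∑ σ, Real.log (m σ).factorial := by
    rw [← Real.log_prod fun σ _ => by positivity, eq_sub_iff_add_eq',
      ← Real.log_mul (prod_ne_zero_iff.2 fun σ _ => by positivity)
        (by exact_mod_cast (Nat.multinomial_pos (s := univ) (f := m)).ne')]
    rw [← hm, ← Nat.multinomial_spec univ m]
    push_cast
    rfl
  have hsum : (∑ σ, (m σ : ℝ)) = n := by exact_mod_cast hm
  have hlow : ∑ σ, ((m σ : ℝ) * Real.log (m σ) - m σ) ≤ ∑ σ, Real.log (m σ).factorial :=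
    sum_le_sum fun σ _ => (log_factorial_bounds _).1
  have hlog : ∀ σ, Real.log (m σ) ≤ Real.log n := by
    intro σ
    rcases Nat.eq_zero_or_pos (m σ) with h | h
    · simpa [h] using Real.log_natCast_nonneg n
    · refine Real.log_le_log (by exact_mod_cast h) ?_
      exact_mod_cast hm ▸ single_le_sum (fun _ _ => Nat.zero_le _) (mem_univ σ)
  have hup : ∑ σ, Real.log (m σ).factorial ≤
      ∑ σ, ((m σ : ℝ) * Real.log (m σ) - m σ) + Fintype.card Ω * (1 + Real.log n) := by
    calc _ ≤ ∑ σ, ((m σ : ℝ) * Real.log (m σ) - m σ + (1 + Real.log n)) :=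
          sum_le_sum fun σ _ => (log_factorial_bounds _).2.trans (by linarith [hlog σ])
      _ = _ := by rw [sum_add_distrib, sum_const, nsmul_eq_mul, card_univ]
  rw [sum_sub_distrib, hsum] at hlow hup
  have hb := log_factorial_bounds n
  have hn0 : 0 ≤ 1 + Real.log n := by linarith [Real.log_natCast_nonneg n]
  have hK : 0 ≤ (Fintype.card Ω : ℝ) * (1 + Real.log n) := by positivity
  rw [hspec, abs_le]
  constructor <;> linarith [hb.1, hb.2]

theorem eventually_mul_one_add_log_le (C ε : ℝ) (hε : 0 < ε) :
    ∀ᶠ n : ℕ in Filter.atTop, C * (1 + Real.log n) ≤ ε * n := by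
  have h : (fun x : ℝ => C * (1 + Real.log x)) =o[Filter.atTop] (id : ℝ → ℝ) :=
    ((Asymptotics.isLittleO_const_id_atTop (1 : ℝ)).add Real.isLittleO_log_id_atTop).const_mul_left C
  filter_upwards [tendsto_natCast_atTop_atTop.eventually (h.bound hε)] with n hn
  simpa using (le_abs_self _).trans hn

theorem splitDist_cwDual (q c n : ℕ) (x : Fin n → Fin c → Fin (q + 2)) (σ : Fin c → Fin 3) :
    splitDist q c n (fun t p => cwDual q (x t p)) σ =
      splitDist q c n x fun p => 2 - σ p := by
  have h : ∀ a b : Fin 3, 2 - a = b ↔ a = 2 - b := by decide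
  simp only [splitDist, blkF_cwDual, funext_iff, h]

theorem splitDist_zero (q c n : ℕ) (hn : n ≠ 0) (σ : Fin c → Fin 3) :
    splitDist q c n (fun _ _ => 0) σ = if σ = fun _ => 0 then 1 else 0 := by
  have h0 : blkF q 0 = 0 := (blkF_eq_zero_iff q 0).2 rfl
  have hn' : (n : ℝ) ≠ 0 := by exact_mod_cast hn
  by_cases h : σ = fun _ => 0
  · simp [splitDist, h0, h, hn']
  · simp [splitDist, h0, h, Ne.symm h]

/-- A sequence all of whose chunks have type zero is the zero sequence. -/
theorem eq_zero_of_splitDist (q c n : ℕ) (hn : n ≠ 0) (z : Fin n → Fin c → Fin (q + 2))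
    (hz : splitDist q c n z (fun _ => 0) = 1) : z = fun _ _ => 0 := by
  have hn' : (n : ℝ) ≠ 0 := by exact_mod_cast hn
  rw [splitDist, div_eq_one_iff_eq hn'] at hz
  have hcard : (univ.filter fun t => (fun p => blkF q (z t p)) = fun _ => 0).card =
      (univ : Finset (Fin n)).card := by
    rw [card_univ, Fintype.card_fin]
    exact_mod_cast hz
  have huniv := (card_eq_iff_eq_univ _).1 (hcard.trans card_univ)
  funext t p
  have ht := huniv ▸ mem_univ t
  exact (blkF_eq_zero_iff q _).1 (congrFun (mem_filter.1 ht).2 p)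

theorem prod_cwCoef_zero_right (q c n : ℕ) (x y : Fin n → Fin c → Fin (q + 2)) :
    (∏ t, ∏ p, cwCoef q (x t p) (y t p) 0) =
      if y = fun t p => cwDual q (x t p) then 1 else 0 := by
  simp only [cwCoef_zero_right, prod_ite_zero, prod_const_one, mem_univ, true_imp_iff, funext_iff]

/-- Logarithmic size of the set of variables with a prescribed complete split distribution. -/
theorem abs_logb_card_splitDist_sub_le (q c n : ℕ) (hq : 1 ≤ q) (hn : 1 ≤ n)
    (β : (Fin c → Fin 3) → ℝ) (hsum : (∑ σ, β σ) = 1) (hint : ∀ σ, ∃ m : ℕ, β σ * n = m) :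
    |Real.logb 2 ((univ.filter fun x => splitDist q c n x = β).card : ℝ) -
        ((n : ℝ) * (-∑ σ, β σ * Real.logb 2 (β σ)) +
          (∑ σ, β σ * ((univ.filter fun p => σ p = (1 : Fin 3)).card : ℝ)) * n *
            Real.logb 2 q)| ≤
      (Fintype.card (Fin c → Fin 3) + 1) / Real.log 2 * (1 + Real.log n) := by
  have hn0 : (n : ℝ) ≠ 0 := by positivity
  choose m hm using hint
  have hβ : ∀ σ, β σ = m σ / n := fun σ => by rw [← hm, mul_div_cancel_right₀ _ hn0]
  have hms : ∑ σ, m σ = n := by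
    have : (∑ σ, (m σ : ℝ)) = n := by simp_rw [← hm, ← sum_mul, hsum, one_mul]
    exact_mod_cast this
  have hset : (univ.filter fun x => splitDist q c n x = β) =
      univ.filter fun x : Fin n → Fin c → Fin (q + 2) =>
        ∀ σ, (univ.filter fun t => (fun p => blkF q (x t p)) = σ).card = m σ := by
    ext x
    simp only [mem_filter, mem_univ, true_and, funext_iff (f := splitDist q c n x), hβ, splitDist,
      div_left_inj' hn0, Nat.cast_inj]
  have hcard := card_filter_fiber_counts
    (fun (a : Fin c → Fin (q + 2)) p => blkF q (a p)) n m hms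
  simp only [card_filter_blkF_comp] at hcard
  have hq0 : (q : ℝ) ≠ 0 := by positivity
  have hlog : Real.log ((univ.filter fun x => splitDist q c n x = β).card : ℝ) =
      Real.log (Nat.multinomial univ m) +
        (∑ σ, (m σ : ℝ) * ((univ.filter fun p => σ p = (1 : Fin 3)).card : ℝ)) *
          Real.log q := by
    rw [hset, hcard]
    push_cast
    rw [Real.log_mul (by exact_mod_cast (Nat.multinomial_pos (s := univ) (f := m)).ne')
      (prod_ne_zero_iff.2 fun σ _ => by positivity), Real.log_prod fun σ _ => by positivity,
      sum_mul]
    congr 1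
    refine sum_congr rfl fun σ _ => ?_
    rw [Real.log_pow, Real.log_pow]
    ring
  have hent : (n : ℝ) * (-∑ σ, β σ * Real.log (β σ)) =
      n * Real.log n - ∑ σ, m σ * Real.log (m σ) := by
    have h : ∀ σ, (n : ℝ) * (β σ * Real.log (β σ)) =
        m σ * Real.log (m σ) - m σ * Real.log n := by
      intro σ
      rw [← mul_assoc, mul_comm (n : ℝ), hm]
      rcases Nat.eq_zero_or_pos (m σ) with h | h
      · simp [h]
      · rw [hβ, Real.log_div (by positivity) hn0, mul_sub]
    rw [mul_neg, mul_sum, sum_congr rfl fun σ _ => h σ, sum_sub_distrib, ← sum_mul,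
      ← Nat.cast_sum, hms]
    ring
  have hlin : (∑ σ, β σ * ((univ.filter fun p => σ p = (1 : Fin 3)).card : ℝ)) * n =
      ∑ σ, (m σ : ℝ) * ((univ.filter fun p => σ p = (1 : Fin 3)).card : ℝ) := by
    rw [sum_mul]
    exact sum_congr rfl fun σ _ => by rw [← hm]; ring
  have hl2 : 0 < Real.log 2 := Real.log_pos one_lt_two
  have hdiv : (∑ σ, β σ * Real.logb 2 (β σ)) = (∑ σ, β σ * Real.log (β σ)) / Real.log 2 := by
    rw [sum_div]
    exact sum_congr rfl fun σ _ => by rw [Real.logb, mul_div_assoc]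
  rw [hdiv, hlin, Real.logb, Real.logb, hlog]
  have key := abs_log_multinomial_sub_le n m hms
  rw [← hent] at key
  rw [div_mul_eq_mul_div, le_div_iff₀ hl2, ← abs_of_pos hl2, ← abs_mul, abs_of_pos hl2]
  refine le_of_eq_of_le (congrArg _ ?_) key
  field_simp
  ring

/-- The constituent tensor `T_{i,j,0}^{⊗n}[β_X, β_Y, β_Z]` (third index `0`, exact complete
split distributions enforced) is isomorphic to an inner-product tensor `⟨1, M, 1⟩`, where
`M`, the number of remaining `X`-variables, equals
`2^{n(H(β_X) ± o(1))} · q^{n ∑_σ β_X(σ)·#{p : σ_p = 1}}`. -/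
theorem stmt19 (ℓ q : ℕ) (hℓ : 1 ≤ ℓ) (hq : 1 ≤ q) (ε : ℝ) (hε : 0 < ε) :
    ∃ n₀ : ℕ, ∀ n : ℕ, n₀ ≤ n → ∀ i j : ℕ,
      ∀ βX βY βZ : (Fin (2 ^ (ℓ - 1)) → Fin 3) → ℝ,
      i + j = 2 ^ ℓ →
      (∀ σ, 0 ≤ βX σ) → (∑ σ, βX σ) = 1 →
      (∀ σ, βX σ ≠ 0 → (∑ p, (σ p).val) = i) →
      (∀ σ, βY σ = βX fun p => 2 - σ p) →
      (∀ σ, βZ σ = if σ = fun _ => (0 : Fin 3) then 1 else 0) →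
      (∀ σ, ∃ m : ℕ, βX σ * n = m) →
      ∃ (Xs : Finset (Fin n → Fin (2 ^ (ℓ - 1)) → Fin (q + 2)))
        (φ : (Fin n → Fin (2 ^ (ℓ - 1)) → Fin (q + 2)) →
          (Fin n → Fin (2 ^ (ℓ - 1)) → Fin (q + 2))),
        Set.InjOn φ ↑Xs ∧
        (∀ x ∈ Xs,
          crestr q (2 ^ (ℓ - 1)) n βX βY βZ x (φ x) (fun _ _ => (0 : Fin (q + 2))) = 1) ∧
        (∀ x y z, crestr q (2 ^ (ℓ - 1)) n βX βY βZ x y z ≠ 0 →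
          x ∈ Xs ∧ y = φ x ∧ z = fun _ _ => (0 : Fin (q + 2))) ∧
        |Real.logb 2 (Xs.card : ℝ) -
          ((n : ℝ) * (-∑ σ, βX σ * Real.logb 2 (βX σ)) +
            (∑ σ, βX σ * ((univ.filter fun p => σ p = (1 : Fin 3)).card : ℝ)) * n *
              Real.logb 2 q)| ≤ ε * n := by
  set c := 2 ^ (ℓ - 1) with hc
  obtain ⟨n₀, hn₀⟩ := Filter.eventually_atTop.1 (eventually_mul_one_add_log_le
    ((Fintype.card (Fin c → Fin 3) + 1) / Real.log 2) ε hε)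
  refine ⟨max n₀ 1, fun n hn i j βX βY βZ _ _ hsum _ hY hZ hint => ?_⟩
  have hn1 : 1 ≤ n := (le_max_right _ _).trans hn
  have hne : n ≠ 0 := by omega
  refine ⟨univ.filter fun x => splitDist q c n x = βX, fun x t p => cwDual q (x t p),
    fun x _ y _ h => ?_, fun x hx => ?_, fun x y z h => ?_, ?_⟩
  · funext t p
    exact (cwDual_involutive q).injective (congrFun (congrFun h t) p)
  · have hx' := (mem_filter.1 hx).2
    have hy' : splitDist q c n (fun t p => cwDual q (x t p)) = βY := by
      funext σ
      rw [splitDist_cwDual, hx', hY]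
    have hz' : splitDist q c n (fun _ _ => 0) = βZ := by
      funext σ
      rw [splitDist_zero q c n hne, hZ]
    rw [crestr, if_pos ⟨hx', hy', hz'⟩, prod_cwCoef_zero_right, if_pos rfl]
  · rw [crestr, ne_eq, ite_eq_right_iff, Classical.not_imp] at h
    obtain ⟨⟨hx, -, hz⟩, hprod⟩ := h
    have hz0 : z = fun _ _ => 0 :=
      eq_zero_of_splitDist q c n hne z (by rw [hz, hZ, if_pos rfl])
    rw [hz0, prod_cwCoef_zero_right, ite_eq_right_iff, Classical.not_imp] at hprod
    exact ⟨mem_filter.2 ⟨mem_univ _, hx⟩, hprod.1, hz0⟩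
  · exact (abs_logb_card_splitDist_sub_le q c n hq hn1 βX hsum hint).trans
      (hn₀ n ((le_max_left _ _).trans hn))
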